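/- Moment bounds for the coefficients along the scheme (Lemma 3.1): under Assumption 2.1, Assumption 3.1 and the commutativity condition L^{j₁}g_{j₂}(x) = L^{j₂}g_{j₁}(x) for all x and all j₁, j₂, for each p ≥ 1 there is a finite constant C (independent of N) such that for every N ∈ ℕ, every setup as below, every n ∈ {0,…,N} and all j₁, j₂ ∈ {1,…,m}: E‖ϕ(Y_n)‖^p ≤ C, E‖φ(Y_n)‖^p ≤ C, E‖f′(Y_n)‖^p ≤ C, E‖g(Y_n)‖^p ≤ C, and E‖L^{j₁}g_{j₂}(Y_n)‖^p ≤ C. -/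

import Mathlib

open MeasureTheory ProbabilityTheory Real Finset
open scoped RealInnerProductSpace ENNReal NNReal

noncomputable section

abbrev Vec (n : ℕ) : Type := EuclideanSpace ℝ (Fin n)

/-- The `d × m` matrix with columns `g j x`, viewed as a continuous linear map `ℝ^m → ℝ^d`. -/
def Gclm {d m : ℕ} (g : Fin m → Vec d → Vec d) (x : Vec d) : Vec m →L[ℝ] Vec d :=
  LinearMap.toContinuousLinearMap
  { toFun := fun w => ∑ j, w j • g j x
    map_add' := by
      intro w w'
      simp [PiLp.add_apply, add_smul, Finset.sum_add_distrib]
    map_smul' := by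
      intro c w
      simp [PiLp.smul_apply, smul_smul, Finset.smul_sum] }

/-- `L^{j₁} g_{j₂} (x) = (Dg_{j₂})(x) · g_{j₁}(x)`. -/
def Lg {d m : ℕ} (g : Fin m → Vec d → Vec d) (j₁ j₂ : Fin m) (x : Vec d) : Vec d :=
  fderiv ℝ (g j₂) x (g j₁ x)

/-- One step of the semi-tamed Milstein scheme with stepsize `h`, drift parts `ph` (Lipschitz)
and `ps` (tamed), diffusion columns `g`, current state `y` and Brownian increment `w`. -/
def milstep {d m : ℕ} (h : ℝ) (ph ps : Vec d → Vec d) (g : Fin m → Vec d → Vec d)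
    (y : Vec d) (w : Vec m) : Vec d :=
  y + h • ph y + (h / (1 + ‖ps y‖ * h)) • ps y + Gclm g y w
    + (2⁻¹ : ℝ) • ∑ j₁, ∑ j₂, (w j₁ * w j₂ - (if j₁ = j₂ then h else 0)) • Lg g j₁ j₂ y

/-- The quantity `α` associated with a state `y` and an increment `w`. -/
def alph {d m : ℕ} (h : ℝ) (g : Fin m → Vec d → Vec d) (y : Vec d) (w : Vec m) : ℝ :=
  if 1 ≤ ‖y‖ then
    ⟪‖y‖⁻¹ • y, ‖y‖⁻¹ • (Gclm g y w)⟫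
      + ⟪‖y‖⁻¹ • y,
          (2 * ‖y‖)⁻¹ • ∑ j₁, ∑ j₂, (w j₁ * w j₂ - (if j₁ = j₂ then h else 0)) • Lg g j₁ j₂ y⟫
  else 0

/-- The constant `λ`. -/
def lamc {d m : ℕ} (T K : ℝ) (ph ps : Vec d → Vec d) (g : Fin m → Vec d → Vec d) : ℝ :=
  (1 + 4 * T * K + 2 * T * (‖ph 0‖ + ‖ps 0‖) + 2 * K + 2 * ‖Gclm g 0‖
    + (m : ℝ) ^ 2 * (T + 1) * (K + ⨆ j : Fin m × Fin m, ‖Lg g j.1 j.2 0‖)) ^ 2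

/-- The dominating process `D_n`, given `λ`, `‖ξ‖`, the squared increment norms and the `α`'s. -/
def Dproc (lam ξnorm : ℝ) (w2 al : ℕ → ℝ) (n : ℕ) : ℝ :=
  (lam + ξnorm) * Real.exp (lam +
    (Finset.range (n + 1)).sup' Finset.nonempty_range_add_one
      (fun u => ∑ k ∈ Finset.Ico u n, (lam * w2 k + al k)))

end

noncomputable section

lemma one_add_pow_le_taylor (k : ℕ) {x : ℝ} (hx : -1 ≤ x) :
    (1 + x) ^ k ≤ 1 + k * x + k ^ 2 * (x ^ 2 * (2 + x ^ 2) ^ k) := by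
  induction k with
  | zero => simp
  | succ k ih =>
    have hP : 1 ≤ (2 + x ^ 2) ^ k := one_le_pow₀ (by nlinarith [sq_nonneg x])
    have hk : (0 : ℝ) ≤ k := Nat.cast_nonneg k
    have hx2 : 1 + x ≤ 2 + x ^ 2 := by nlinarith [sq_nonneg (x - 1), sq_nonneg x]
    have h1 : (1 + x) ^ (k + 1)
        ≤ (1 + k * x + k ^ 2 * (x ^ 2 * (2 + x ^ 2) ^ k)) * (1 + x) := by
      rw [pow_succ]
      exact mul_le_mul_of_nonneg_right ih (by linarith)
    have h2 : k ^ 2 * (x ^ 2 * (2 + x ^ 2) ^ k) * (1 + x)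
        ≤ k ^ 2 * (x ^ 2 * (2 + x ^ 2) ^ k) * (2 + x ^ 2) :=
      mul_le_mul_of_nonneg_left hx2 (by positivity)
    have h3 : (k : ℝ) * x ^ 2 ≤ k * (x ^ 2 * (2 + x ^ 2) ^ (k + 1)) := by
      refine mul_le_mul_of_nonneg_left (le_mul_of_one_le_right (sq_nonneg x) ?_) hk
      exact one_le_pow₀ (by nlinarith [sq_nonneg x])
    have h4 : 0 ≤ ((k : ℝ) + 1) * (x ^ 2 * (2 + x ^ 2) ^ (k + 1)) := by positivity
    push_cast
    rw [pow_succ (2 + x ^ 2)] at h3 h4 ⊢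
    nlinarith

lemma one_add_pow_symm_le (k : ℕ) {u r e : ℝ} (h₁ : -1 ≤ r + u) (h₂ : -1 ≤ r - u)
    (he : 2 * u ^ 2 + 2 * r ^ 2 ≤ e) :
    (1 + (r + u)) ^ k + (1 + (r - u)) ^ k ≤ 2 * (1 + (k * r + k ^ 2 * (e * (2 + e) ^ k))) := by
  have key : ∀ x : ℝ, x ^ 2 ≤ e → x ^ 2 * (2 + x ^ 2) ^ k ≤ e * (2 + e) ^ k := by
    intro x hx
    have := (sq_nonneg x).trans hx
    gcongr
  have e₁ := key (r + u) (by nlinarith [sq_nonneg (r - u)])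
  have e₂ := key (r - u) (by nlinarith [sq_nonneg (r + u)])
  have t₁ := one_add_pow_le_taylor k h₁
  have t₂ := one_add_pow_le_taylor k h₂
  have hk : (0 : ℝ) ≤ (k : ℝ) ^ 2 := by positivity
  nlinarith [mul_le_mul_of_nonneg_left e₁ hk, mul_le_mul_of_nonneg_left e₂ hk]

/-- A Lyapunov estimate for a symmetrised perturbation `B ± G` of a state with weight `V`. -/
lemma lyapunov_symm_le {E : Type*} [NormedAddCommGroup E] [InnerProductSpace ℝ E] (k : ℕ)
    {B G : E} {V a b : ℝ} (hV : 1 ≤ V) (ha : 0 ≤ a) (hB : 1 + ‖B‖ ^ 2 ≤ V * (1 + a))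
    (hG : ‖G‖ ^ 2 ≤ V * b) {e : ℝ} (he : 8 * ((1 + a) * b) + 2 * (a + b) ^ 2 ≤ e) :
    (1 + ‖B + G‖ ^ 2) ^ k + (1 + ‖B - G‖ ^ 2) ^ k
      ≤ V ^ k * (2 * (1 + (k * (a + b) + k ^ 2 * (e * (2 + e) ^ k)))) := by
  have hV0 : 0 < V := by linarith
  set u : ℝ := 2 * ⟪B, G⟫ / V with hu
  have hVu : V * u = 2 * ⟪B, G⟫ := by rw [hu]; field_simp
  have hb : 0 ≤ b := by
    by_contra! h
    nlinarith [sq_nonneg ‖G‖]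
  have hp : 1 + ‖B + G‖ ^ 2 ≤ V * (1 + ((a + b) + u)) := by
    rw [norm_add_sq_real]; nlinarith
  have hm : 1 + ‖B - G‖ ^ 2 ≤ V * (1 + ((a + b) - u)) := by
    rw [norm_sub_sq_real]; nlinarith
  have hp0 : 0 ≤ 1 + ((a + b) + u) := by
    by_contra! h
    nlinarith [sq_nonneg ‖B + G‖]
  have hm0 : 0 ≤ 1 + ((a + b) - u) := by
    by_contra! h
    nlinarith [sq_nonneg ‖B - G‖]
  have hu2 : u ^ 2 ≤ 4 * ((1 + a) * b) := by
    have h1 : ⟪B, G⟫ ^ 2 ≤ ‖B‖ ^ 2 * ‖G‖ ^ 2 := by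
      rw [← mul_pow, ← sq_abs]
      exact pow_le_pow_left₀ (abs_nonneg _) (abs_real_inner_le_norm B G) 2
    have h2 : ‖B‖ ^ 2 * ‖G‖ ^ 2 ≤ (V * (1 + a)) * (V * b) :=
      mul_le_mul (by linarith) hG (by positivity) (by positivity)
    have h3 : V ^ 2 * u ^ 2 ≤ V ^ 2 * (4 * ((1 + a) * b)) := by
      rw [← mul_pow, hVu]; nlinarith
    exact le_of_mul_le_mul_left h3 (by positivity)
  have hs := one_add_pow_symm_le k (u := u) (r := a + b) (e := e) (by linarith) (by linarith)
    (by linarith)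
  calc (1 + ‖B + G‖ ^ 2) ^ k + (1 + ‖B - G‖ ^ 2) ^ k
      ≤ (V * (1 + ((a + b) + u))) ^ k + (V * (1 + ((a + b) - u))) ^ k := by gcongr
    _ = V ^ k * ((1 + ((a + b) + u)) ^ k + (1 + ((a + b) - u)) ^ k) := by
      rw [mul_pow, mul_pow]; ring
    _ ≤ _ := by gcongr

/-- A one-sided Lipschitz map dominates its own norm by its radial part, up to a quadratic term. -/
lemma inner_add_norm_le_of_oneSidedLipschitz {E : Type*} [NormedAddCommGroup E]
    [InnerProductSpace ℝ E] {F : E → E} {κ B : ℝ}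
    (hF : ∀ x y, ⟪x - y, F x - F y⟫ ≤ κ * ‖x - y‖ ^ 2) (hκ : 0 ≤ κ)
    (hB : ∀ z, ‖z‖ ≤ 1 → ‖F z‖ ≤ B) (x : E) :
    ⟪x, F x⟫ + ‖F x‖ ≤ 2 * (B + κ) * (1 + ‖x‖ ^ 2) := by
  have hB0 : 0 ≤ B := (norm_nonneg _).trans (hB 0 (by simp))
  set z : E := -(‖F x‖⁻¹ • F x) with hz
  have hz1 : ‖z‖ ≤ 1 := by
    rw [hz, norm_neg, norm_smul, norm_inv, norm_norm]
    exact inv_mul_le_one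
  have hzF : ⟪z, F x⟫ = -‖F x‖ := by
    rw [hz, inner_neg_left, real_inner_smul_left, real_inner_self_eq_norm_sq]
    rcases eq_or_ne ‖F x‖ 0 with h | h
    · simp [h]
    · field_simp
  have hxz : ‖x - z‖ ≤ ‖x‖ + 1 := (norm_sub_le x z).trans (by linarith)
  have h1 := hF x z
  rw [inner_sub_right, inner_sub_left x z (F x), hzF] at h1
  have h2 : ⟪x - z, F z⟫ ≤ (‖x‖ + 1) * B :=
    (real_inner_le_norm _ _).trans
      (mul_le_mul hxz (hB z hz1) (norm_nonneg _) (by positivity))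
  have h3 : κ * ‖x - z‖ ^ 2 ≤ κ * (‖x‖ + 1) ^ 2 := by gcongr
  nlinarith [mul_nonneg hκ (sq_nonneg (‖x‖ - 1)), mul_nonneg hB0 (sq_nonneg (‖x‖ - 1)),
    mul_nonneg hB0 (sq_nonneg ‖x‖)]

/-- Taming keeps the drift step stable for the squared norm. -/
lemma norm_tamed_add_sq_le {E : Type*} [NormedAddCommGroup E] [InnerProductSpace ℝ E]
    {y v : E} {h L : ℝ} (hh : 0 ≤ h) (hL : 0 ≤ L)
    (hv : ⟪y, v⟫ + ‖v‖ ≤ L * (1 + ‖y‖ ^ 2)) :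
    ‖y + (h / (1 + ‖v‖ * h)) • v‖ ^ 2 ≤ ‖y‖ ^ 2 + 2 * h * L * (1 + ‖y‖ ^ 2) := by
  have hd : 0 < 1 + ‖v‖ * h := by positivity
  set s := h / (1 + ‖v‖ * h) with hs
  have hs0 : 0 ≤ s := by positivity
  have hsh : s ≤ h := div_le_self hh (by nlinarith [norm_nonneg v])
  have hsv : s * ‖v‖ ≤ 1 := by
    rw [hs, div_mul_eq_mul_div, div_le_one hd]; nlinarith
  rw [norm_add_sq_real, real_inner_smul_right, norm_smul, Real.norm_of_nonneg hs0]
  have h1 : (s * ‖v‖) ^ 2 ≤ 2 * (s * ‖v‖) := by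
    nlinarith [mul_nonneg hs0 (norm_nonneg v)]
  have h2 := mul_le_mul_of_nonneg_left hv hs0
  have h3 : s * (L * (1 + ‖y‖ ^ 2)) ≤ h * (L * (1 + ‖y‖ ^ 2)) := by gcongr
  nlinarith

lemma norm_add_sq_le_of_norm_le_mul {E : Type*} [NormedAddCommGroup E] [InnerProductSpace ℝ E]
    {z e : E} {h D : ℝ} (hh : 0 ≤ h) (he : ‖e‖ ≤ h * D) :
    ‖z + e‖ ^ 2 ≤ (1 + h) * ‖z‖ ^ 2 + (h + h ^ 2) * D ^ 2 := by
  have h1 : ‖z + e‖ ≤ ‖z‖ + h * D := (norm_add_le z e).trans (by linarith)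
  have h2 : ‖z + e‖ ^ 2 ≤ (‖z‖ + h * D) ^ 2 := by gcongr
  nlinarith [mul_nonneg hh (sq_nonneg (‖z‖ - D))]

lemma norm_iterated_correction_le {d m : ℕ} {g : Fin m → Vec d → Vec d} {h R : ℝ} {y : Vec d}
    {w : Vec m} (hh : 0 ≤ h) (hR : ∀ i j, ‖Lg g i j y‖ ≤ R) :
    ‖(2⁻¹ : ℝ) • ∑ j₁, ∑ j₂, (w j₁ * w j₂ - (if j₁ = j₂ then h else 0)) • Lg g j₁ j₂ y‖
      ≤ (m : ℝ) ^ 2 * ((‖w‖ ^ 2 + h) * R) := by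
  have hterm : ∀ i j : Fin m,
      ‖(w i * w j - (if i = j then h else 0)) • Lg g i j y‖ ≤ (‖w‖ ^ 2 + h) * R := by
    intro i j
    rw [norm_smul]
    refine mul_le_mul ?_ (hR i j) (norm_nonneg _) (by positivity)
    refine (norm_sub_le _ _).trans (add_le_add ?_ ?_)
    · rw [norm_mul, sq]
      exact mul_le_mul (PiLp.norm_apply_le w i) (PiLp.norm_apply_le w j) (norm_nonneg _)
        (norm_nonneg _)
    · split_ifs <;> simp [abs_of_nonneg, hh]
  have hsum : ‖∑ j₁, ∑ j₂, (w j₁ * w j₂ - (if j₁ = j₂ then h else 0)) • Lg g j₁ j₂ y‖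
      ≤ (m : ℝ) ^ 2 * ((‖w‖ ^ 2 + h) * R) := by
    refine (norm_sum_le_of_le _ fun i _ => norm_sum_le_of_le _ fun j _ => hterm i j).trans ?_
    simp [sq, mul_assoc]
  rw [norm_smul]
  have := norm_nonneg (∑ j₁, ∑ j₂, (w j₁ * w j₂ - (if j₁ = j₂ then h else 0)) • Lg g j₁ j₂ y)
  norm_num
  linarith

lemma taylor_remainder_le (k : ℕ) {c₁ c₂ c₃ h T W : ℝ} (hc₁ : 0 ≤ c₁) (hc₂ : 0 ≤ c₂)
    (hc₃ : 0 ≤ c₃) (h0 : 0 ≤ h) (hT : h ≤ T) (hW : 1 ≤ W) :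
    k * (h * (c₁ * W ^ 4) + h * (c₂ * W ^ 4))
        + (k : ℝ) ^ 2 * (h * (c₃ * W ^ 8) * (2 + h * (c₃ * W ^ 8)) ^ k)
      ≤ h * ((k * (c₁ + c₂) + k ^ 2 * (c₃ * (2 + T * c₃) ^ k)) * W ^ (8 + 8 * k)) := by
  have hW4 : W ^ 4 ≤ W ^ (8 + 8 * k) := pow_le_pow_right₀ hW (by omega)
  have hW8 : 1 ≤ W ^ 8 := one_le_pow₀ hW
  have hbase : 2 + h * (c₃ * W ^ 8) ≤ (2 + T * c₃) * W ^ 8 := by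
    have h1 : h * (c₃ * W ^ 8) ≤ T * (c₃ * W ^ 8) := by gcongr
    linarith
  calc _ ≤ k * (h * (c₁ * W ^ (8 + 8 * k)) + h * (c₂ * W ^ (8 + 8 * k)))
      + (k : ℝ) ^ 2 * (h * (c₃ * W ^ 8) * ((2 + T * c₃) * W ^ 8) ^ k) := by gcongr
    _ = _ := by rw [mul_pow, ← pow_mul, pow_add]; ring

set_option maxHeartbeats 1000000 in
/-- One-step moment estimate, symmetrised in the direction `z` of the increment. -/
lemma milstep_symm_le {d m : ℕ} {ph ps : Vec d → Vec d} {g : Fin m → Vec d → Vec d} {T L : ℝ}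
    (hT : 0 ≤ T) (hL : 0 ≤ L)
    (hph : ∀ x, ‖ph x‖ ≤ L * (1 + ‖x‖)) (hps : ∀ x, ⟪x, ps x⟫ + ‖ps x‖ ≤ L * (1 + ‖x‖ ^ 2))
    (hG : ∀ x, ‖Gclm g x‖ ≤ L * (1 + ‖x‖)) (hLg : ∀ i j x, ‖Lg g i j x‖ ≤ L * (1 + ‖x‖))
    (k : ℕ) :
    ∃ C : ℝ, 0 ≤ C ∧ ∀ (σ : ℝ), σ ^ 2 ≤ T → ∀ (y : Vec d) (z : Vec m),
      (1 + ‖milstep (σ ^ 2) ph ps g y (σ • z)‖ ^ 2) ^ k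
        + (1 + ‖milstep (σ ^ 2) ph ps g y ((-σ) • z)‖ ^ 2) ^ k
      ≤ (1 + ‖y‖ ^ 2) ^ k * (2 * (1 + σ ^ 2 * (C * (1 + ‖z‖) ^ (8 + 8 * k)))) := by
  set c₁ : ℝ := 1 + 2 * L * (1 + T) + (1 + T) * (2 * L ^ 2 * (1 + (m : ℝ) ^ 2) ^ 2) with hc₁
  set c₂ : ℝ := 2 * L ^ 2 with hc₂
  set c₃ : ℝ := 8 * ((1 + T * c₁) * c₂) + 2 * (T * (c₁ + c₂) ^ 2) with hc₃
  have hc₁0 : 0 ≤ c₁ := by positivity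
  have hc₂0 : 0 ≤ c₂ := by positivity
  have hc₃0 : 0 ≤ c₃ := by positivity
  refine ⟨k * (c₁ + c₂) + k ^ 2 * (c₃ * (2 + T * c₃) ^ k), by positivity, ?_⟩
  intro σ hσT y z
  set h : ℝ := σ ^ 2 with hh
  have h0 : 0 ≤ h := sq_nonneg σ
  set W : ℝ := 1 + ‖z‖ with hW
  have hW1 : 1 ≤ W := by simp [hW]
  have hz : ‖z‖ ≤ W := by simp [hW]
  have hzW : ‖z‖ ^ 2 + 1 ≤ W ^ 2 := by rw [hW]; nlinarith [norm_nonneg z]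
  set n : ℝ := ‖y‖ with hn
  have hn0 : 0 ≤ n := norm_nonneg y
  set V : ℝ := 1 + n ^ 2 with hV
  have hV1 : 1 ≤ V := by rw [hV]; nlinarith
  have hnV : (1 + n) ^ 2 ≤ 2 * V := by rw [hV]; nlinarith [sq_nonneg (n - 1)]
  have hW2 : 1 ≤ W ^ 2 := one_le_pow₀ hW1
  have hW4 : 1 ≤ W ^ 4 := one_le_pow₀ hW1
  have hW8 : 1 ≤ W ^ 8 := one_le_pow₀ hW1
  set Z : Vec d := y + (h / (1 + ‖ps y‖ * h)) • ps y with hZ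
  set S : Vec d := (2⁻¹ : ℝ) • ∑ j₁, ∑ j₂,
    ((σ • z) j₁ * (σ • z) j₂ - (if j₁ = j₂ then h else 0)) • Lg g j₁ j₂ y with hS
  have hplus : milstep h ph ps g y (σ • z) = (Z + (h • ph y + S)) + Gclm g y (σ • z) := by
    simp only [milstep, hZ, hS]; abel
  have hminus : milstep h ph ps g y ((-σ) • z) = (Z + (h • ph y + S)) - Gclm g y (σ • z) := by
    have hneg : (-σ) • z = -(σ • z) := neg_smul σ z
    simp only [milstep, hZ, hS, hneg, map_neg, PiLp.neg_apply, neg_mul_neg]; abel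
  rw [hplus, hminus]
  have hSn : ‖S‖ ≤ h * ((m : ℝ) ^ 2 * (W ^ 2 * (L * (1 + n)))) := by
    refine (norm_iterated_correction_le h0 fun i j => hLg i j y).trans ?_
    have : ‖σ • z‖ ^ 2 + h = h * (‖z‖ ^ 2 + 1) := by
      rw [norm_smul, mul_pow, Real.norm_eq_abs, sq_abs]; ring
    rw [this]
    calc (m : ℝ) ^ 2 * (h * (‖z‖ ^ 2 + 1) * (L * (1 + n)))
        ≤ (m : ℝ) ^ 2 * (h * W ^ 2 * (L * (1 + n))) := by gcongr
      _ = _ := by ring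
  have hE : ‖h • ph y + S‖ ≤ h * (L * (1 + (m : ℝ) ^ 2) * W ^ 2 * (1 + n)) := by
    have h1 : ‖h • ph y‖ ≤ h * (W ^ 2 * (L * (1 + n))) := by
      rw [norm_smul, Real.norm_of_nonneg h0]
      refine mul_le_mul_of_nonneg_left ((hph y).trans ?_) h0
      exact le_mul_of_one_le_left (by positivity) hW2
    refine (norm_add_le _ _).trans ((add_le_add h1 hSn).trans (le_of_eq ?_))
    ring
  have hZn : ‖Z‖ ^ 2 ≤ n ^ 2 + 2 * h * L * V := norm_tamed_add_sq_le h0 hL (hps y)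
  have hD : (L * (1 + (m : ℝ) ^ 2) * W ^ 2 * (1 + n)) ^ 2
      ≤ 2 * L ^ 2 * (1 + (m : ℝ) ^ 2) ^ 2 * (V * W ^ 4) := by
    calc _ = L ^ 2 * (1 + (m : ℝ) ^ 2) ^ 2 * W ^ 4 * (1 + n) ^ 2 := by ring
      _ ≤ L ^ 2 * (1 + (m : ℝ) ^ 2) ^ 2 * W ^ 4 * (2 * V) := by gcongr
      _ = _ := by ring
  have hB : 1 + ‖Z + (h • ph y + S)‖ ^ 2 ≤ V * (1 + h * (c₁ * W ^ 4)) := by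
    calc 1 + ‖Z + (h • ph y + S)‖ ^ 2
        ≤ 1 + ((1 + h) * ‖Z‖ ^ 2
            + (h + h ^ 2) * (L * (1 + (m : ℝ) ^ 2) * W ^ 2 * (1 + n)) ^ 2) := by
          gcongr; exact norm_add_sq_le_of_norm_le_mul h0 hE
      _ ≤ 1 + ((1 + h) * (n ^ 2 + 2 * h * L * V)
            + (h + h ^ 2) * (2 * L ^ 2 * (1 + (m : ℝ) ^ 2) ^ 2 * (V * W ^ 4))) := by gcongr
      _ = V + h * (n ^ 2 + 2 * L * (1 + h) * V
            + (1 + h) * (2 * L ^ 2 * (1 + (m : ℝ) ^ 2) ^ 2) * (V * W ^ 4)) := by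
          rw [hV]; ring
      _ ≤ V + h * (V * W ^ 4 + 2 * L * (1 + T) * (V * W ^ 4)
            + (1 + T) * (2 * L ^ 2 * (1 + (m : ℝ) ^ 2) ^ 2) * (V * W ^ 4)) := by
          have hVW : V ≤ V * W ^ 4 := le_mul_of_one_le_right (by linarith) hW4
          have hnV' : n ^ 2 ≤ V * W ^ 4 := by linarith
          gcongr
      _ = V * (1 + h * (c₁ * W ^ 4)) := by rw [hc₁]; ring
  have hGn : ‖Gclm g y (σ • z)‖ ^ 2 ≤ V * (h * (c₂ * W ^ 4)) := by
    have h1 : ‖Gclm g y (σ • z)‖ ≤ L * (1 + n) * (|σ| * W) := by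
      refine ((Gclm g y).le_opNorm _).trans ?_
      rw [norm_smul, Real.norm_eq_abs]
      exact mul_le_mul (hG y) (by gcongr) (by positivity) (by positivity)
    calc _ ≤ (L * (1 + n) * (|σ| * W)) ^ 2 := by gcongr
      _ = L ^ 2 * h * W ^ 2 * (1 + n) ^ 2 := by rw [hh, ← sq_abs σ]; ring
      _ ≤ L ^ 2 * h * W ^ 4 * (2 * V) := by gcongr; norm_num
      _ = _ := by rw [hc₂]; ring
  have he : 8 * ((1 + h * (c₁ * W ^ 4)) * (h * (c₂ * W ^ 4)))
      + 2 * (h * (c₁ * W ^ 4) + h * (c₂ * W ^ 4)) ^ 2 ≤ h * (c₃ * W ^ 8) := by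
    calc _ = h * (8 * ((W ^ 4 + h * c₁ * W ^ 8) * c₂) + 2 * (h * (c₁ + c₂) ^ 2 * W ^ 8)) := by
          ring
      _ ≤ h * (8 * ((W ^ 8 + T * c₁ * W ^ 8) * c₂) + 2 * (T * (c₁ + c₂) ^ 2 * W ^ 8)) := by
          gcongr; norm_num
      _ = _ := by rw [hc₃]; ring
  refine (lyapunov_symm_le k hV1 (by positivity) hB hGn he).trans ?_
  have hfin := taylor_remainder_le k hc₁0 hc₂0 hc₃0 h0 hσT hW1
  gcongr

/-- The law of an `m`-dimensional Gaussian increment is a scaled standard Gaussian law. -/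
lemma map_toLp_pi_gaussianReal_eq {m : ℕ} {σ h : ℝ} (hσ : σ ^ 2 = h) :
    Measure.map (WithLp.toLp 2) (Measure.pi (fun _ : Fin m => gaussianReal 0 (Real.toNNReal h)))
      = Measure.map (fun z : Vec m => σ • z) (stdGaussian (Vec m)) := by
  have hv : Real.toNNReal h = NNReal.mk (σ ^ 2) (sq_nonneg σ) * 1 := by
    rw [mul_one, ← hσ]
    exact Real.toNNReal_of_nonneg (sq_nonneg σ)
  have h1 : gaussianReal 0 (Real.toNNReal h) = (gaussianReal 0 1).map (σ * ·) := by
    rw [gaussianReal_map_const_mul, mul_zero, hv]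
  rw [← map_pi_eq_stdGaussian, Measure.map_map (by fun_prop) (by fun_prop), h1,
    ← Measure.pi_map_pi (fun _ => by fun_prop), Measure.map_map (by fun_prop) (by fun_prop)]
  rfl

lemma lintegral_one_add_norm_pow_stdGaussian_ne_top (m r : ℕ) :
    ∫⁻ z : Vec m, ENNReal.ofReal ((1 + ‖z‖) ^ r) ∂(stdGaussian (Vec m)) ≠ ∞ := by
  have hnorm : MemLp (fun z : Vec m => ‖z‖) r (stdGaussian (Vec m)) :=
    (IsGaussian.memLp_id (stdGaussian (Vec m)) r (ENNReal.natCast_ne_top r)).norm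
  have hone : MemLp (fun _ : Vec m => (1 : ℝ)) r (stdGaussian (Vec m)) := memLp_const 1
  have hid : MemLp (fun z : Vec m => 1 + ‖z‖) r (stdGaussian (Vec m)) := hone.add hnorm
  have hint : Integrable (fun z : Vec m => (1 + ‖z‖) ^ r) (stdGaussian (Vec m)) := by
    refine hid.integrable_norm_pow'.congr (Filter.Eventually.of_forall fun z => ?_)
    simp only [Real.norm_of_nonneg (by positivity : 0 ≤ 1 + ‖z‖)]
  exact hint.lintegral_lt_top.ne

lemma lintegral_gaussian_le_of_symm {m r : ℕ} {F : Vec m → ℝ≥0∞} (hF : Measurable F) {h : ℝ}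
    (h0 : 0 ≤ h) {V c : ℝ≥0∞}
    (hsymm : ∀ z : Vec m, F (√h • z) + F ((-√h) • z)
      ≤ V * (2 * (1 + c * ENNReal.ofReal ((1 + ‖z‖) ^ r)))) :
    ∫⁻ w, F w ∂(Measure.map (WithLp.toLp 2)
        (Measure.pi (fun _ : Fin m => gaussianReal 0 (Real.toNNReal h))))
      ≤ V * (1 + c * ∫⁻ z : Vec m, ENNReal.ofReal ((1 + ‖z‖) ^ r) ∂(stdGaussian (Vec m))) := by
  have hscale : ∀ σ : ℝ, σ ^ 2 = h →
      ∫⁻ w, F w ∂(Measure.map (WithLp.toLp 2)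
          (Measure.pi (fun _ : Fin m => gaussianReal 0 (Real.toNNReal h))))
        = ∫⁻ z, F (σ • z) ∂(stdGaussian (Vec m)) := by
    intro σ hσ
    rw [map_toLp_pi_gaussianReal_eq hσ, lintegral_map hF (by fun_prop)]
  have hsq : √h ^ 2 = h := Real.sq_sqrt h0
  refine (ENNReal.mul_le_mul_iff_right two_ne_zero ENNReal.ofNat_ne_top).1 ?_
  calc 2 * ∫⁻ w, F w ∂(Measure.map (WithLp.toLp 2)
        (Measure.pi (fun _ : Fin m => gaussianReal 0 (Real.toNNReal h))))
      = ∫⁻ z, (F (√h • z) + F ((-√h) • z)) ∂(stdGaussian (Vec m)) := by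
        rw [lintegral_add_left (by fun_prop), ← hscale _ hsq, ← hscale _ (by rw [neg_sq, hsq]),
          two_mul]
    _ ≤ ∫⁻ z, V * (2 * (1 + c * ENNReal.ofReal ((1 + ‖z‖) ^ r))) ∂(stdGaussian (Vec m)) :=
        lintegral_mono hsymm
    _ = V * (2 * (1 + c * ∫⁻ z : Vec m, ENNReal.ofReal ((1 + ‖z‖) ^ r)
          ∂(stdGaussian (Vec m)))) := by
        rw [lintegral_const_mul _ (by fun_prop), lintegral_const_mul _ (by fun_prop),
          lintegral_add_left (by fun_prop), lintegral_const_mul _ (by fun_prop)]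
        simp
    _ = _ := by ring

lemma lintegral_milstep_le {d m : ℕ} {ph ps : Vec d → Vec d} {g : Fin m → Vec d → Vec d}
    {T L : ℝ} (hT : 0 ≤ T) (hL : 0 ≤ L)
    (hph : ∀ x, ‖ph x‖ ≤ L * (1 + ‖x‖)) (hps : ∀ x, ⟪x, ps x⟫ + ‖ps x‖ ≤ L * (1 + ‖x‖ ^ 2))
    (hG : ∀ x, ‖Gclm g x‖ ≤ L * (1 + ‖x‖)) (hLg : ∀ i j x, ‖Lg g i j x‖ ≤ L * (1 + ‖x‖))
    (hmeas : ∀ h : ℝ, 0 ≤ h → Measurable fun q : Vec d × Vec m => milstep h ph ps g q.1 q.2)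
    (k : ℕ) :
    ∃ C : ℝ, 0 ≤ C ∧ ∀ (h : ℝ), 0 ≤ h → h ≤ T → ∀ y : Vec d,
      ∫⁻ w, ENNReal.ofReal ((1 + ‖milstep h ph ps g y w‖ ^ 2) ^ k)
        ∂(Measure.map (WithLp.toLp 2)
          (Measure.pi (fun _ : Fin m => gaussianReal 0 (Real.toNNReal h))))
      ≤ ENNReal.ofReal (1 + h * C) * ENNReal.ofReal ((1 + ‖y‖ ^ 2) ^ k) := by
  obtain ⟨C₀, hC₀, hstep⟩ := milstep_symm_le hT hL hph hps hG hLg k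
  obtain ⟨J, hJ⟩ : ∃ J, J = ∫⁻ z : Vec m, ENNReal.ofReal ((1 + ‖z‖) ^ (8 + 8 * k))
    ∂(stdGaussian (Vec m)) := ⟨_, rfl⟩
  have hJtop : J ≠ ∞ := hJ ▸ lintegral_one_add_norm_pow_stdGaussian_ne_top m _
  refine ⟨C₀ * J.toReal, mul_nonneg hC₀ ENNReal.toReal_nonneg, ?_⟩
  intro h h0 hhT y
  have hpair : Measurable fun w : Vec m => (y, w) := by fun_prop
  have hmy : Measurable fun w => milstep h ph ps g y w := by
    simpa only [Function.comp_def] using (hmeas h h0).comp hpair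
  have hsq : √h ^ 2 = h := Real.sq_sqrt h0
  have hJC : ENNReal.ofReal (1 + h * (C₀ * J.toReal)) = 1 + ENNReal.ofReal (h * C₀) * J := by
    rw [← mul_assoc, ENNReal.ofReal_add zero_le_one
      (mul_nonneg (mul_nonneg h0 hC₀) ENNReal.toReal_nonneg),
      ENNReal.ofReal_mul (mul_nonneg h0 hC₀), ENNReal.ofReal_toReal hJtop, ENNReal.ofReal_one]
  rw [hJC, mul_comm (1 + ENNReal.ofReal (h * C₀) * J), hJ]
  have hFm : Measurable fun w => ENNReal.ofReal ((1 + ‖milstep h ph ps g y w‖ ^ 2) ^ k) := by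
    fun_prop
  refine lintegral_gaussian_le_of_symm hFm h0 ?_
  intro z
  have hz := hstep (√h) (hsq.le.trans hhT) y z
  rw [hsq] at hz
  have hW : 0 ≤ (1 + ‖z‖) ^ (8 + 8 * k) := by positivity
  have hcW : ENNReal.ofReal (2 * (1 + h * (C₀ * (1 + ‖z‖) ^ (8 + 8 * k))))
      = 2 * (1 + ENNReal.ofReal (h * C₀) * ENNReal.ofReal ((1 + ‖z‖) ^ (8 + 8 * k))) := by
    rw [ENNReal.ofReal_mul zero_le_two, ← mul_assoc,
      ENNReal.ofReal_add zero_le_one (mul_nonneg (mul_nonneg h0 hC₀) hW),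
      ENNReal.ofReal_mul (mul_nonneg h0 hC₀), ENNReal.ofReal_one, ENNReal.ofReal_ofNat]
  rw [← hcW, ← ENNReal.ofReal_mul (by positivity),
    ← ENNReal.ofReal_add (by positivity) (by positivity)]
  exact ENNReal.ofReal_le_ofReal hz

lemma continuous_milstep {d m : ℕ} {ph ps : Vec d → Vec d} {g : Fin m → Vec d → Vec d}
    (hph : Continuous ph) (hps : Continuous ps) (hg : ∀ j, Continuous (g j))
    (hLg : ∀ i j, Continuous (Lg g i j)) {h : ℝ} (h0 : 0 ≤ h) :
    Continuous fun q : Vec d × Vec m => milstep h ph ps g q.1 q.2 := by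
  have hGq : Continuous fun q : Vec d × Vec m => Gclm g q.1 q.2 := by
    change Continuous fun q : Vec d × Vec m => ∑ j, q.2 j • g j q.1
    fun_prop
  have hden : ∀ q : Vec d × Vec m, 1 + ‖ps q.1‖ * h ≠ 0 := fun q => by positivity
  unfold milstep
  fun_prop (disch := assumption)

lemma indepFun_prodMk_left_of_indepFun_prodMk_right {Ω α β γ : Type*} {mΩ : MeasurableSpace Ω} {P : Measure Ω}
    [IsProbabilityMeasure P] [MeasurableSpace α] [MeasurableSpace β] [MeasurableSpace γ]
    {X : Ω → α} {Y : Ω → β} {Z : Ω → γ} (hX : Measurable X) (hY : Measurable Y)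
    (hZ : Measurable Z) (hXYZ : IndepFun X (fun ω => (Y ω, Z ω)) P) (hYZ : IndepFun Y Z P) :
    IndepFun (fun ω => (X ω, Y ω)) Z P := by
  have hXY : IndepFun X Y P := hXYZ.comp measurable_id measurable_fst
  have := Measure.isProbabilityMeasure_map (μ := P) hX.aemeasurable
  have := Measure.isProbabilityMeasure_map (μ := P) hY.aemeasurable
  have := Measure.isProbabilityMeasure_map (μ := P) hZ.aemeasurable
  rw [indepFun_iff_map_prod_eq_prod_map_map (by fun_prop) (by fun_prop)] at hXYZ hYZ hXY ⊢
  rw [hXY]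
  have hassoc := (measurePreserving_prodAssoc (P.map X) (P.map Y) (P.map Z)).symm
  rw [hYZ] at hXYZ
  rw [← hassoc.map_eq, ← hXYZ, Measure.map_map (by fun_prop) (by fun_prop)]
  rfl

/-- The state reached after `n` steps of a recursion driven by the sequence `w`. -/
def iterState {α β : Type*} (F : α → β → α) (x : α) (w : ℕ → β) : ℕ → α
  | 0 => x
  | n + 1 => F (iterState F x w n) (w n)

lemma iterState_congr {α β : Type*} (F : α → β → α) (x : α) {w w' : ℕ → β} {n : ℕ}
    (h : ∀ k < n, w k = w' k) : iterState F x w n = iterState F x w' n := by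
  induction n with
  | zero => rfl
  | succ n ih =>
    simp only [iterState]
    rw [ih fun k hk => h k (hk.trans n.lt_succ_self), h n n.lt_succ_self]

lemma measurable_iterState {α β : Type*} [MeasurableSpace α] [MeasurableSpace β] {F : α → β → α}
    (hF : Measurable fun q : α × β => F q.1 q.2) (n : ℕ) :
    Measurable fun q : α × (ℕ → β) => iterState F q.1 q.2 n := by
  induction n with
  | zero => exact measurable_fst
  | succ n ih =>
    exact hF.comp (ih.prodMk ((measurable_pi_apply n).comp measurable_snd))

/-- The state of a recursion driven by independent noise is independent of the next noise term. -/
lemma indepFun_recursion {Ω α β : Type*} {mΩ : MeasurableSpace Ω} {P : Measure Ω}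
    [IsProbabilityMeasure P] [MeasurableSpace α] [MeasurableSpace β] [Zero β] {F : α → β → α}
    (hF : Measurable fun q : α × β => F q.1 q.2) {ξ : Ω → α} {W : ℕ → Ω → β} {Y : ℕ → Ω → α}
    (hξ : Measurable ξ) (hW : ∀ k, Measurable (W k)) (hWi : iIndepFun W P)
    (hξW : IndepFun ξ (fun ω k => W k ω) P) (hY0 : ∀ ω, Y 0 ω = ξ ω)
    (hY : ∀ n ω, Y (n + 1) ω = F (Y n ω) (W n ω)) (n : ℕ) :
    Measurable (Y n) ∧ IndepFun (Y n) (W n) P := by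
  have hYit : ∀ n ω, Y n ω = iterState F (ξ ω) (fun k => W k ω) n := by
    intro n ω
    induction n with
    | zero => exact hY0 ω
    | succ n ih => rw [hY, ih, iterState]
  set U : Ω → ℕ → β := fun ω k => if k < n then W k ω else 0 with hU
  have hYU : Y n = (fun q : α × (ℕ → β) => iterState F q.1 q.2 n) ∘ fun ω => (ξ ω, U ω) := by
    ext ω
    rw [hYit]
    exact iterState_congr F _ fun k hk => by simp [hU, hk]
  have htrunc : Measurable fun (w : ℕ → β) (k : ℕ) => if k < n then w k else 0 := by
    refine measurable_pi_lambda _ fun k => ?_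
    by_cases hk : k < n
    · simpa [hk] using measurable_pi_apply k
    · simp [hk]
  have hseq : Measurable fun ω k => W k ω := measurable_pi_lambda _ hW
  have hUm : Measurable U := htrunc.comp hseq
  have hUW : IndepFun U (W n) P := by
    have hdisj : Disjoint (Finset.range n) {n} := by simp
    have hext : Measurable fun (v : Finset.range n → β) (k : ℕ) =>
        if hk : k < n then v ⟨k, Finset.mem_range.2 hk⟩ else 0 := by
      refine measurable_pi_lambda _ fun k => ?_
      by_cases hk : k < n
      · simpa [hk] using measurable_pi_apply _
      · simp [hk]
    exact (hWi.indepFun_finset _ _ hdisj hW).comp hext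
      (measurable_pi_apply (⟨n, Finset.mem_singleton_self n⟩ : ({n} : Finset ℕ)))
  have hξUW : IndepFun ξ (fun ω => (U ω, W n ω)) P :=
    hξW.comp measurable_id (htrunc.prodMk (measurable_pi_apply n))
  rw [hYU]
  exact ⟨(measurable_iterState hF n).comp (hξ.prodMk hUm),
    (indepFun_prodMk_left_of_indepFun_prodMk_right hξ hUm (hW n) hξUW hUW).comp (measurable_iterState hF n)
      measurable_id⟩

/-- Uniform even moments of the scheme: the Lyapunov function grows at most exponentially. -/
lemma lintegral_scheme_le {d m : ℕ} {ph ps : Vec d → Vec d} {g : Fin m → Vec d → Vec d}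
    {T C : ℝ} (hT : 0 ≤ T) (hC : 0 ≤ C) {k : ℕ}
    (hmeas : ∀ h : ℝ, 0 ≤ h → Measurable fun q : Vec d × Vec m => milstep h ph ps g q.1 q.2)
    (hstep : ∀ (h : ℝ), 0 ≤ h → h ≤ T → ∀ y : Vec d,
      ∫⁻ w, ENNReal.ofReal ((1 + ‖milstep h ph ps g y w‖ ^ 2) ^ k)
        ∂(Measure.map (WithLp.toLp 2)
          (Measure.pi (fun _ : Fin m => gaussianReal 0 (Real.toNNReal h))))
      ≤ ENNReal.ofReal (1 + h * C) * ENNReal.ofReal ((1 + ‖y‖ ^ 2) ^ k))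
    {N : ℕ} (hN : 0 < N) {Ω : Type*} {mΩ : MeasurableSpace Ω} {P : Measure Ω}
    [IsProbabilityMeasure P] {ξ : Ω → Vec d} {ΔW : ℕ → Ω → Vec m} {Y : ℕ → Ω → Vec d}
    (hξ : Measurable ξ) (hW : ∀ k, Measurable (ΔW k))
    (hlaw : ∀ k, Measure.map (ΔW k) P = Measure.map (WithLp.toLp 2)
      (Measure.pi (fun _ : Fin m => gaussianReal 0 (Real.toNNReal (T / N)))))
    (hWi : iIndepFun ΔW P) (hξW : IndepFun ξ (fun ω k => ΔW k ω) P) (hY0 : ∀ ω, Y 0 ω = ξ ω)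
    (hY : ∀ n ω, Y (n + 1) ω = milstep (T / N) ph ps g (Y n ω) (ΔW n ω)) {n : ℕ} (hn : n ≤ N) :
    ∫⁻ ω, ENNReal.ofReal ((1 + ‖Y n ω‖ ^ 2) ^ k) ∂P
      ≤ ENNReal.ofReal (Real.exp (T * C))
        * ∫⁻ x, ENNReal.ofReal ((1 + ‖x‖ ^ 2) ^ k) ∂(Measure.map ξ P) := by
  have hN' : (0 : ℝ) < N := by exact_mod_cast hN
  have h0 : 0 ≤ T / N := by positivity
  have hhT : T / N ≤ T := div_le_self hT (by exact_mod_cast hN)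
  have hind := indepFun_recursion (hmeas _ h0) hξ hW hWi hξW hY0 hY
  have hgrow : ∀ n, ∫⁻ ω, ENNReal.ofReal ((1 + ‖Y n ω‖ ^ 2) ^ k) ∂P
      ≤ ENNReal.ofReal (1 + T / N * C) ^ n
        * ∫⁻ x, ENNReal.ofReal ((1 + ‖x‖ ^ 2) ^ k) ∂(Measure.map ξ P) := by
    intro n
    induction n with
    | zero =>
      rw [lintegral_map (by fun_prop) hξ]
      simp [hY0]
    | succ n ih =>
      obtain ⟨hYm, hYW⟩ := hind n
      have hjoint := (indepFun_iff_map_prod_eq_prod_map_map hYm.aemeasurable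
        (hW n).aemeasurable).1 hYW
      have := Measure.isProbabilityMeasure_map (μ := P) hYm.aemeasurable
      have := Measure.isProbabilityMeasure_map (μ := P) (hW n).aemeasurable
      have hms := hmeas _ h0
      have hFm : Measurable fun q : Vec d × Vec m =>
          ENNReal.ofReal ((1 + ‖milstep (T / N) ph ps g q.1 q.2‖ ^ 2) ^ k) := by fun_prop
      calc ∫⁻ ω, ENNReal.ofReal ((1 + ‖Y (n + 1) ω‖ ^ 2) ^ k) ∂P
          = ∫⁻ q, ENNReal.ofReal ((1 + ‖milstep (T / N) ph ps g q.1 q.2‖ ^ 2) ^ k)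
              ∂(P.map fun ω => (Y n ω, ΔW n ω)) := by
            rw [lintegral_map hFm (hYm.prodMk (hW n))]
            simp only [hY]
        _ = ∫⁻ y, ∫⁻ w, ENNReal.ofReal ((1 + ‖milstep (T / N) ph ps g y w‖ ^ 2) ^ k)
              ∂(P.map (ΔW n)) ∂(P.map (Y n)) := by
            rw [hjoint, lintegral_prod _ hFm.aemeasurable]
        _ ≤ ∫⁻ y, ENNReal.ofReal (1 + T / N * C) * ENNReal.ofReal ((1 + ‖y‖ ^ 2) ^ k)
              ∂(P.map (Y n)) := by
            refine lintegral_mono fun y => ?_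
            rw [hlaw n]
            exact hstep _ h0 hhT y
        _ = ENNReal.ofReal (1 + T / N * C) * ∫⁻ ω, ENNReal.ofReal ((1 + ‖Y n ω‖ ^ 2) ^ k) ∂P := by
            rw [lintegral_const_mul _ (by fun_prop), lintegral_map (by fun_prop) hYm]
        _ ≤ _ := by
            rw [pow_succ', mul_assoc]
            gcongr
  refine (hgrow n).trans ?_
  gcongr
  rw [← ENNReal.ofReal_pow (by positivity)]
  refine ENNReal.ofReal_le_ofReal ?_
  calc (1 + T / N * C) ^ n ≤ (1 + T / N * C) ^ N :=
        pow_le_pow_right₀ (by nlinarith [mul_nonneg h0 hC]) hn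
    _ ≤ Real.exp (T / N * C) ^ N := by
        gcongr
        linarith [Real.add_one_le_exp (T / N * C)]
    _ = Real.exp (T * C) := by
        rw [← Real.exp_nat_mul]
        congr 1
        field_simp

lemma lintegral_one_add_norm_sq_pow_ne_top {E : Type*} [NormedAddCommGroup E] [MeasurableSpace E]
    {μ : Measure E} (hμ : ∀ r : ℕ, Integrable (fun x => ‖x‖ ^ r) μ) (k : ℕ) :
    ∫⁻ x, ENNReal.ofReal ((1 + ‖x‖ ^ 2) ^ k) ∂μ ≠ ∞ := by
  have hint : Integrable (fun x : E => (1 + ‖x‖ ^ 2) ^ k) μ := by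
    simp_rw [add_pow, one_pow, one_mul, ← pow_mul]
    exact integrable_finsetSum _ fun i _ => (hμ _).mul_const _
  exact hint.lintegral_lt_top.ne

lemma norm_le_of_lipschitz_bound {E F : Type*} [NormedAddCommGroup E] [NormedAddCommGroup F]
    {f : E → F} {K : ℝ} (hf : ∀ x y, ‖f x - f y‖ ≤ K * ‖x - y‖) (x : E) :
    ‖f x‖ ≤ ‖f 0‖ + K * ‖x‖ := by
  have h1 := hf x 0
  rw [sub_zero] at h1
  linarith [norm_sub_norm_le (f x) (f 0)]

lemma continuous_of_lipschitz_bound {E F : Type*} [NormedAddCommGroup E] [NormedAddCommGroup F]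
    {f : E → F} {K : ℝ} (hf : ∀ x y, ‖f x - f y‖ ≤ K * ‖x - y‖) : Continuous f := by
  refine (LipschitzWith.of_dist_le_mul (K := K.toNNReal) fun x y => ?_).continuous
  rw [dist_eq_norm, dist_eq_norm]
  exact (hf x y).trans (by gcongr; exact Real.le_coe_toNNReal K)

lemma norm_le_of_norm_fderiv_le_rpow {E F : Type*} [NormedAddCommGroup E] [NormedSpace ℝ E]
    [NormedAddCommGroup F] [NormedSpace ℝ F] {f : E → F} {K c : ℝ} (hK : 0 ≤ K) (hc : 0 ≤ c)
    (hf : Differentiable ℝ f) (hf' : ∀ x, ‖fderiv ℝ f x‖ ≤ K * ‖x‖ ^ c) (x : E) :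
    ‖f x‖ ≤ ‖f 0‖ + K * ‖x‖ ^ c * ‖x‖ := by
  have h1 : ‖f x - f 0‖ ≤ K * ‖x‖ ^ c * ‖x - 0‖ := by
    refine (convex_closedBall (0 : E) ‖x‖).norm_image_sub_le_of_norm_fderiv_le (𝕜 := ℝ)
      (fun y _ => hf y) (fun y hy => (hf' y).trans ?_) (by simp) (by simp)
    have : ‖y‖ ≤ ‖x‖ := by simpa using hy
    gcongr
  rw [sub_zero] at h1
  linarith [norm_sub_norm_le (f x) (f 0)]

lemma lintegral_rpow_le_of_le {Ω : Type*} {mΩ : MeasurableSpace Ω} {P : Measure Ω} {a v : Ω → ℝ}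
    {A p : ℝ} {r : ℕ} {M : ℝ≥0∞} (hp : 0 ≤ p) (hA : 0 ≤ A) (ha : ∀ ω, 0 ≤ a ω)
    (hv : ∀ ω, 1 ≤ v ω) (hav : ∀ ω, a ω ≤ A * v ω ^ r)
    (hM : ∫⁻ ω, ENNReal.ofReal (v ω ^ (r * ⌈p⌉₊)) ∂P ≤ M) :
    ∫⁻ ω, ENNReal.ofReal (a ω ^ p) ∂P ≤ ENNReal.ofReal (A ^ p) * M := by
  refine le_trans ?_ (mul_le_mul_right hM _)
  rw [← lintegral_const_mul' _ _ ENNReal.ofReal_ne_top]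
  refine lintegral_mono fun ω => ?_
  rw [← ENNReal.ofReal_mul (by positivity)]
  refine ENNReal.ofReal_le_ofReal ?_
  have hv0 : 0 ≤ v ω := zero_le_one.trans (hv ω)
  calc a ω ^ p ≤ (A * v ω ^ r) ^ p := Real.rpow_le_rpow (ha ω) (hav ω) hp
    _ = A ^ p * (v ω ^ r) ^ p := Real.mul_rpow hA (by positivity)
    _ ≤ A ^ p * (v ω ^ r) ^ (⌈p⌉₊ : ℝ) := by
        gcongr
        · exact one_le_pow₀ (hv ω)
        · exact Nat.le_ceil p
    _ = A ^ p * v ω ^ (r * ⌈p⌉₊) := by rw [Real.rpow_natCast, ← pow_mul]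

/-- Linear growth of the Lipschitz coefficients and coercivity of the tamed drift part, with a
common constant. -/
lemma exists_linear_growth {d m : ℕ} {K c : ℝ} (hK : 0 ≤ K) (hc : 0 ≤ c)
    {ph ps : Vec d → Vec d} {g : Fin m → Vec d → Vec d}
    (hOSL : ∀ x y : Vec d, ⟪x - y, (ph x + ps x) - (ph y + ps y)⟫ ≤ K * ‖x - y‖ ^ 2)
    (hgLip : ∀ x y : Vec d, ‖Gclm g x - Gclm g y‖ ≤ K * ‖x - y‖)
    (hphLip : ∀ x y : Vec d, ‖ph x - ph y‖ ≤ K * ‖x - y‖)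
    (hpsd : Differentiable ℝ ps) (hps' : ∀ x : Vec d, ‖fderiv ℝ ps x‖ ≤ K * ‖x‖ ^ c)
    (hLgLip : ∀ (j₁ j₂ : Fin m) (x y : Vec d),
      ‖Lg g j₁ j₂ x - Lg g j₁ j₂ y‖ ≤ K * ‖x - y‖) :
    ∃ A : ℝ, K ≤ A ∧ ‖ps 0‖ ≤ A ∧ (∀ x, ‖ph x‖ ≤ A * (1 + ‖x‖)) ∧
      (∀ x, ⟪x, ps x⟫ + ‖ps x‖ ≤ A * (1 + ‖x‖ ^ 2)) ∧
      (∀ x, ‖Gclm g x‖ ≤ A * (1 + ‖x‖)) ∧ (∀ i j x, ‖Lg g i j x‖ ≤ A * (1 + ‖x‖)) := by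
  have hps0 := norm_le_of_norm_fderiv_le_rpow hK hc hpsd hps'
  have hph0 := norm_le_of_lipschitz_bound hphLip
  have hG0 := norm_le_of_lipschitz_bound hgLip
  have hLg0 := fun i j => norm_le_of_lipschitz_bound (hLgLip i j)
  set S : ℝ := ∑ i : Fin m, ∑ j : Fin m, ‖Lg g i j 0‖ with hS
  have hS0 : 0 ≤ S := by positivity
  have hLgS : ∀ i j, ‖Lg g i j 0‖ ≤ S := fun i j =>
    (Finset.single_le_sum (f := fun j => ‖Lg g i j 0‖) (fun _ _ => norm_nonneg _)
      (Finset.mem_univ j)).trans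
      (Finset.single_le_sum (f := fun i => ∑ j, ‖Lg g i j 0‖)
        (fun _ _ => Finset.sum_nonneg fun _ _ => norm_nonneg _) (Finset.mem_univ i))
  have hpsOSL : ∀ x y : Vec d, ⟪x - y, ps x - ps y⟫ ≤ 2 * K * ‖x - y‖ ^ 2 := by
    intro x y
    have h1 := hOSL x y
    rw [add_sub_add_comm, inner_add_right] at h1
    have h2 : -(‖x - y‖ * (K * ‖x - y‖)) ≤ ⟪x - y, ph x - ph y⟫ := by
      have h3 := (abs_le.1 (abs_real_inner_le_norm (x - y) (ph x - ph y))).1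
      have h4 := mul_le_mul_of_nonneg_left (hphLip x y) (norm_nonneg (x - y))
      linarith
    nlinarith
  have hpsball : ∀ z : Vec d, ‖z‖ ≤ 1 → ‖ps z‖ ≤ ‖ps 0‖ + K := by
    intro z hz
    refine (hps0 z).trans ?_
    have h1 : ‖z‖ ^ c ≤ 1 := Real.rpow_le_one (norm_nonneg z) hz hc
    have h2 : ‖z‖ ^ c * ‖z‖ ≤ 1 := mul_le_one₀ h1 (norm_nonneg z) hz
    nlinarith
  have hpscoer := inner_add_norm_le_of_oneSidedLipschitz hpsOSL (mul_nonneg zero_le_two hK) hpsball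
  set A : ℝ := 2 * (‖ps 0‖ + K + 2 * K) + ‖ph 0‖ + ‖Gclm g 0‖ + S with hA
  have hn1 := norm_nonneg (ph 0)
  have hn2 := norm_nonneg (ps 0)
  have hn3 := norm_nonneg (Gclm g 0)
  have hlin : ∀ {b : ℝ} (x : Vec d), b ≤ A - K → b + K * ‖x‖ ≤ A * (1 + ‖x‖) := by
    intro b x hb
    have : K * ‖x‖ ≤ A * ‖x‖ := by
      gcongr
      linarith
    linarith
  refine ⟨A, by linarith, by linarith, fun x => (hph0 x).trans (hlin x (by linarith)), ?_,
    fun x => (hG0 x).trans (hlin x (by linarith)),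
    fun i j x => (hLg0 i j x).trans (hlin x (by linarith [hLgS i j]))⟩
  intro x
  refine (hpscoer x).trans ?_
  gcongr
  linarith

lemma rpow_norm_le_one_add_sq_pow {E : Type*} [NormedAddCommGroup E] {c : ℝ} (hc : 0 ≤ c)
    (x : E) : ‖x‖ ^ c ≤ (1 + ‖x‖ ^ 2) ^ ⌈c⌉₊ := by
  calc ‖x‖ ^ c ≤ (1 + ‖x‖ ^ 2) ^ c :=
        Real.rpow_le_rpow (norm_nonneg x) (by nlinarith [sq_nonneg (‖x‖ - 1)]) hc
    _ ≤ (1 + ‖x‖ ^ 2) ^ (⌈c⌉₊ : ℝ) :=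
        Real.rpow_le_rpow_of_exponent_le (by nlinarith [sq_nonneg ‖x‖]) (Nat.le_ceil c)
    _ = _ := Real.rpow_natCast _ _

lemma le_mul_one_add_sq_pow_of_le_linear {A b s : ℝ} {r : ℕ} (hA : 0 ≤ A) (hr : r ≠ 0)
    (hb : b ≤ A * (1 + s)) : b ≤ 2 * A * (1 + s ^ 2) ^ r := by
  have hV1 : 1 ≤ 1 + s ^ 2 := by nlinarith [sq_nonneg s]
  have hVr : 1 + s ^ 2 ≤ (1 + s ^ 2) ^ r := le_self_pow₀ hV1 hr
  have hs : 1 + s ≤ 2 * (1 + s ^ 2) ^ r := by nlinarith [sq_nonneg (s - 1)]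
  calc b ≤ A * (1 + s) := hb
    _ ≤ A * (2 * (1 + s ^ 2) ^ r) := by gcongr
    _ = _ := by ring

lemma norm_le_polynomial_of_norm_fderiv_le {E F : Type*} [NormedAddCommGroup E] [NormedSpace ℝ E]
    [NormedAddCommGroup F] [NormedSpace ℝ F] {f : E → F} {K c A : ℝ} (hK : 0 ≤ K) (hc : 0 ≤ c)
    (hKA : K ≤ A) (hA : ‖f 0‖ ≤ A) (hf : Differentiable ℝ f)
    (hf' : ∀ x, ‖fderiv ℝ f x‖ ≤ K * ‖x‖ ^ c) (x : E) :
    ‖f x‖ ≤ 2 * A * (1 + ‖x‖ ^ 2) ^ (⌈c⌉₊ + 1) := by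
  have hA0 : 0 ≤ A := hK.trans hKA
  have hV1 : 1 ≤ 1 + ‖x‖ ^ 2 := by nlinarith [sq_nonneg ‖x‖]
  have hxV : ‖x‖ ≤ 1 + ‖x‖ ^ 2 := by nlinarith [sq_nonneg (‖x‖ - 1)]
  have h1 : ‖x‖ ^ c * ‖x‖ ≤ (1 + ‖x‖ ^ 2) ^ (⌈c⌉₊ + 1) := by
    rw [pow_succ]
    exact mul_le_mul (rpow_norm_le_one_add_sq_pow hc x) hxV (norm_nonneg x) (by positivity)
  have h2 : ‖f 0‖ * 1 ≤ A * (1 + ‖x‖ ^ 2) ^ (⌈c⌉₊ + 1) := by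
    gcongr
    exact one_le_pow₀ hV1
  have h3 : K * (‖x‖ ^ c * ‖x‖) ≤ A * (1 + ‖x‖ ^ 2) ^ (⌈c⌉₊ + 1) := by gcongr
  linarith [norm_le_of_norm_fderiv_le_rpow hK hc hf hf' x]

lemma norm_fderiv_add_le_polynomial {E F : Type*} [NormedAddCommGroup E] [NormedSpace ℝ E]
    [NormedAddCommGroup F] [NormedSpace ℝ F] {f₁ f₂ : E → F} {K c A : ℝ} (hK : 0 ≤ K)
    (hc : 0 ≤ c) (hKA : K ≤ A) (hf : Differentiable ℝ fun x => f₁ x + f₂ x)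
    (hf₁ : ∀ x y, ‖f₁ x - f₁ y‖ ≤ K * ‖x - y‖) (hf₂ : Differentiable ℝ f₂)
    (hf₂' : ∀ x, ‖fderiv ℝ f₂ x‖ ≤ K * ‖x‖ ^ c) (x : E) :
    ‖fderiv ℝ (fun x => f₁ x + f₂ x) x‖ ≤ 2 * A * (1 + ‖x‖ ^ 2) ^ (⌈c⌉₊ + 1) := by
  have hA0 : 0 ≤ A := hK.trans hKA
  have hV1 : 1 ≤ 1 + ‖x‖ ^ 2 := by nlinarith [sq_nonneg ‖x‖]
  have hf₁d : Differentiable ℝ f₁ := by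
    have heq : f₁ = fun x => (f₁ x + f₂ x) - f₂ x :=
      funext fun x => (add_sub_cancel_right _ _).symm
    rw [heq]
    exact hf.fun_sub hf₂
  have h1 : ‖fderiv ℝ f₁ x‖ ≤ K :=
    norm_fderiv_le_of_lip' ℝ hK (Filter.Eventually.of_forall fun y => hf₁ y x)
  rw [fderiv_fun_add (hf₁d x) (hf₂ x)]
  have h2 : ‖x‖ ^ c ≤ (1 + ‖x‖ ^ 2) ^ (⌈c⌉₊ + 1) :=
    (rpow_norm_le_one_add_sq_pow hc x).trans (pow_le_pow_right₀ hV1 (Nat.le_succ _))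
  have h3 : K * 1 ≤ A * (1 + ‖x‖ ^ 2) ^ (⌈c⌉₊ + 1) := by
    gcongr
    exact one_le_pow₀ hV1
  have h4 : K * ‖x‖ ^ c ≤ A * (1 + ‖x‖ ^ 2) ^ (⌈c⌉₊ + 1) := by gcongr
  linarith [norm_add_le (fderiv ℝ f₁ x) (fderiv ℝ f₂ x), hf₂' x]

/-- Lemma 3.1: uniform moment bounds for the coefficients along the scheme. -/
theorem coefficient_moment_bounds_along_scheme
    (d m : ℕ) (hd : 0 < d) (hm : 0 < m)
    (T K c : ℝ) (hT : 0 < T) (hK : 1 ≤ K) (hc : 1 ≤ c)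
    (ph ps : Vec d → Vec d) (g : Fin m → Vec d → Vec d)
    (hgdiff : ∀ j, ContDiff ℝ 1 (g j))
    (hOSL : ∀ x y : Vec d, ⟪x - y, (ph x + ps x) - (ph y + ps y)⟫ ≤ K * ‖x - y‖ ^ 2)
    (hgLip : ∀ x y : Vec d, ‖Gclm g x - Gclm g y‖ ≤ K * ‖x - y‖)
    (hphLip : ∀ x y : Vec d, ‖ph x - ph y‖ ≤ K * ‖x - y‖)
    (hpsC : ContDiff ℝ 1 ps)
    (hps' : ∀ x : Vec d, ‖fderiv ℝ ps x‖ ≤ K * ‖x‖ ^ c)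
    (hLgLip : ∀ (j₁ j₂ : Fin m) (x y : Vec d), ‖Lg g j₁ j₂ x - Lg g j₁ j₂ y‖ ≤ K * ‖x - y‖)
    (q : ℝ) (hq : 1 ≤ q)
    (hfC2 : ContDiff ℝ 2 (fun x => ph x + ps x))
    (hgC2 : ∀ i, ContDiff ℝ 2 (g i))
    (hf'' : ∀ x : Vec d, ‖iteratedFDeriv ℝ 2 (fun x => ph x + ps x) x‖ ≤ K * (1 + ‖x‖ ^ q))
    (hg'' : ∀ (i : Fin m) (x : Vec d), ‖iteratedFDeriv ℝ 2 (g i) x‖ ≤ K)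
    (hcomm : ∀ (j₁ j₂ : Fin m) (x : Vec d), Lg g j₁ j₂ x = Lg g j₂ j₁ x)
    (μξ : Measure (Vec d)) (hμξprob : IsProbabilityMeasure μξ)
    (hμξmom : ∀ r : ℕ, Integrable (fun x => ‖x‖ ^ r) μξ)
    (p : ℝ) (hp : 1 ≤ p) :
    ∃ C : ℝ, ∀ (N : ℕ), 0 < N →
      ∀ (Ω : Type) (mΩ : MeasurableSpace Ω) (P : Measure Ω), IsProbabilityMeasure P →
      ∀ (ξ : Ω → Vec d) (ΔW : ℕ → Ω → Vec m) (Y : ℕ → Ω → Vec d),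
        Measurable ξ → (∀ k, Measurable (ΔW k)) →
        Measure.map ξ P = μξ →
        (∀ k, Measure.map (ΔW k) P
            = Measure.map (WithLp.toLp 2)
                (Measure.pi (fun _ : Fin m => gaussianReal 0 (Real.toNNReal (T / N))))) →
        iIndepFun ΔW P →
        IndepFun ξ (fun ω k => ΔW k ω) P →
        (∀ ω, Y 0 ω = ξ ω) →
        (∀ n ω, Y (n + 1) ω = milstep (T / N) ph ps g (Y n ω) (ΔW n ω)) →
        ∀ n ≤ N, ∀ j₁ j₂ : Fin m,
          (∫⁻ ω, ENNReal.ofReal (‖ph (Y n ω)‖ ^ p) ∂P ≤ ENNReal.ofReal C)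
          ∧ (∫⁻ ω, ENNReal.ofReal (‖ps (Y n ω)‖ ^ p) ∂P ≤ ENNReal.ofReal C)
          ∧ (∫⁻ ω, ENNReal.ofReal (‖fderiv ℝ (fun x => ph x + ps x) (Y n ω)‖ ^ p) ∂P
              ≤ ENNReal.ofReal C)
          ∧ (∫⁻ ω, ENNReal.ofReal (‖Gclm g (Y n ω)‖ ^ p) ∂P ≤ ENNReal.ofReal C)
          ∧ (∫⁻ ω, ENNReal.ofReal (‖Lg g j₁ j₂ (Y n ω)‖ ^ p) ∂P ≤ ENNReal.ofReal C) := by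
  have hK0 : 0 ≤ K := by linarith
  have hc0 : 0 ≤ c := by linarith
  have hpsd : Differentiable ℝ ps := hpsC.differentiable one_ne_zero
  obtain ⟨A, hKA, hps0A, hphA, hpsA, hGA, hLgA⟩ :=
    exists_linear_growth hK0 hc0 hOSL hgLip hphLip hpsd hps' hLgLip
  have hA0 : 0 ≤ A := hK0.trans hKA
  have hmeas : ∀ h : ℝ, 0 ≤ h → Measurable fun q : Vec d × Vec m => milstep h ph ps g q.1 q.2 :=
    fun h h0 => (continuous_milstep (continuous_of_lipschitz_bound hphLip) hpsC.continuous
      (fun j => (hgdiff j).continuous) (fun i j => continuous_of_lipschitz_bound (hLgLip i j))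
      h0).measurable
  obtain ⟨r, hr⟩ : ∃ r, r = ⌈c⌉₊ + 1 := ⟨_, rfl⟩
  have hr0 : r ≠ 0 := by omega
  obtain ⟨C, hC, hstep⟩ := lintegral_milstep_le hT.le hA0 hphA hpsA hGA hLgA hmeas (r * ⌈p⌉₊)
  set M : ℝ≥0∞ := ENNReal.ofReal (Real.exp (T * C))
    * ∫⁻ x, ENNReal.ofReal ((1 + ‖x‖ ^ 2) ^ (r * ⌈p⌉₊)) ∂μξ with hM
  have hMtop : M ≠ ∞ := ENNReal.mul_ne_top ENNReal.ofReal_ne_top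
    (lintegral_one_add_norm_sq_pow_ne_top hμξmom _)
  refine ⟨(ENNReal.ofReal ((2 * A) ^ p) * M).toReal, ?_⟩
  intro N hN Ω mΩ P hP ξ ΔW Y hξ hW hξlaw hlaw hWi hξW hY0 hY n hn j₁ j₂
  rw [ENNReal.ofReal_toReal (ENNReal.mul_ne_top ENNReal.ofReal_ne_top hMtop)]
  have hYM : ∫⁻ ω, ENNReal.ofReal ((1 + ‖Y n ω‖ ^ 2) ^ (r * ⌈p⌉₊)) ∂P ≤ M := by
    rw [hM, ← hξlaw]
    exact lintegral_scheme_le hT.le hC hmeas hstep hN hξ hW hlaw hWi hξW hY0 hY hn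
  have key : ∀ a : Vec d → ℝ, (∀ x, 0 ≤ a x) → (∀ x, a x ≤ 2 * A * (1 + ‖x‖ ^ 2) ^ r) →
      ∫⁻ ω, ENNReal.ofReal (a (Y n ω) ^ p) ∂P ≤ ENNReal.ofReal ((2 * A) ^ p) * M :=
    fun a ha0 ha => lintegral_rpow_le_of_le (v := fun ω => 1 + ‖Y n ω‖ ^ 2) (by linarith)
      (by positivity) (fun ω => ha0 _) (fun ω => le_add_of_nonneg_right (sq_nonneg _)) (fun ω => ha _) hYM
  have key_linear : ∀ a : Vec d → ℝ, (∀ x, 0 ≤ a x) → (∀ x, a x ≤ A * (1 + ‖x‖)) →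
      ∫⁻ ω, ENNReal.ofReal (a (Y n ω) ^ p) ∂P ≤ ENNReal.ofReal ((2 * A) ^ p) * M :=
    fun a ha0 ha => key a ha0 fun x => le_mul_one_add_sq_pow_of_le_linear hA0 hr0 (ha x)
  have hpsr : ∀ x, ‖ps x‖ ≤ 2 * A * (1 + ‖x‖ ^ 2) ^ r :=
    hr ▸ norm_le_polynomial_of_norm_fderiv_le hK0 hc0 hKA hps0A hpsd hps'
  have hfr : ∀ x, ‖fderiv ℝ (fun x => ph x + ps x) x‖ ≤ 2 * A * (1 + ‖x‖ ^ 2) ^ r :=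
    hr ▸ norm_fderiv_add_le_polynomial hK0 hc0 hKA (hfC2.differentiable two_ne_zero) hphLip hpsd
      hps'
  exact ⟨key_linear (fun x => ‖ph x‖) (fun _ => norm_nonneg _) hphA,
    key (fun x => ‖ps x‖) (fun _ => norm_nonneg _) hpsr,
    key (fun x => ‖fderiv ℝ (fun x => ph x + ps x) x‖) (fun _ => norm_nonneg _) hfr,
    key_linear (fun x => ‖Gclm g x‖) (fun _ => norm_nonneg _) hGA,
    key_linear (fun x => ‖Lg g j₁ j₂ x‖) (fun _ => norm_nonneg _) (hLgA j₁ j₂)⟩
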